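/- arXiv:1812.11618 — 2 statements merged into one kernel-verified Lean document; each statement's English description precedes it below -/
import Mathlib

section
/- Let A be a complex Banach algebra with identity and let a ∈ A. Then a has a generalized Hirano inverse if and only if both (a² + a)/2 and (a² − a)/2 have gs-Drazin inverses. -/
/-- `a` is quasinilpotent: `1 + a*x` is invertible for every `x` commuting with `a`. -/
def Quasinilpotent {A : Type*} [Ring A] (a : A) : Prop :=
  ∀ x : A, x * a = a * x → IsUnit (1 + a * x)

/-- `b` is a g-Drazin inverse of `a`. -/
def IsGDrazinInv {A : Type*} [Ring A] (a b : A) : Prop :=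
  b = b * a * b ∧ a * b = b * a ∧ Quasinilpotent (a - a ^ 2 * b)

/-- `b` is a gs-Drazin inverse of `a`. -/
def IsGSDrazinInv {A : Type*} [Ring A] (a b : A) : Prop :=
  b = b * a * b ∧ a * b = b * a ∧ Quasinilpotent (a - a * b)

/-- `b` is a generalized Hirano inverse of `a`. -/
def IsGenHiranoInv {A : Type*} [Ring A] (a b : A) : Prop :=
  b = b * a * b ∧ a * b = b * a ∧ Quasinilpotent (a ^ 2 - a * b)

set_option linter.unusedSimpArgs false
open Filter Topology in
theorem qn_decay {A : Type*} [NormedRing A] [NormedAlgebra ℂ A] [CompleteSpace A] (a : A)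
    (h : ∀ z : ℂ, IsUnit (1 + z • a)) (ε : ℝ) (hε : 0 < ε) :
    ∀ᶠ n : ℕ in atTop, ‖a ^ n‖ ≤ ε ^ n := by
  have hs : spectralRadius ℂ a = 0 := by
    unfold spectralRadius
    simp only [ENNReal.iSup_eq_zero]
    intro z hz
    by_contra hne
    have hz0 : z ≠ 0 := by
      rintro rfl
      simp at hne
    apply hz
    have h1 := h (-z⁻¹)
    have h2 : algebraMap ℂ A z - a = z • (1 + (-z⁻¹) • a) := by
      rw [smul_add, smul_smul, Algebra.algebraMap_eq_smul_one]
      simp [hz0, sub_eq_add_neg]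
    change IsUnit (algebraMap ℂ A z - a)
    rw [h2]
    have := (IsUnit.mk0 z hz0).map (algebraMap ℂ A)
    rw [Algebra.smul_def]
    exact this.mul h1
  have ht := spectrum.pow_norm_pow_one_div_tendsto_nhds_spectralRadius a
  rw [hs] at ht
  have h1 : ∀ᶠ n : ℕ in atTop, ENNReal.ofReal (‖a ^ n‖ ^ (1 / (n:ℝ))) < ENNReal.ofReal ε :=
    ht.eventually_lt_const (by simpa using hε)
  filter_upwards [h1, eventually_gt_atTop 0] with n hn hn0
  have h2 := ((ENNReal.ofReal_lt_ofReal_iff hε).1 hn).le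
  have h3 : (‖a ^ n‖ ^ (1 / (n:ℝ))) ^ n ≤ ε ^ n := by gcongr
  rwa [one_div, Real.rpow_inv_natCast_pow (norm_nonneg _) hn0.ne'] at h3

open Filter Topology in
theorem qn_of_scalar {A : Type*} [NormedRing A] [NormedAlgebra ℂ A] [CompleteSpace A] (a : A)
    (h : ∀ z : ℂ, IsUnit (1 + z • a)) : Quasinilpotent a := by
  intro x hx
  have hp : 0 < ‖x‖ + 1 := by positivity
  obtain ⟨n, hn, hn0⟩ := ((qn_decay a h (1 / (2 * (‖x‖ + 1))) (by positivity)).and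
    (eventually_gt_atTop 0)).exists
  have hc : Commute a x := hx.symm
  have h1 : ‖(-(a * x)) ^ n‖ < 1 := by
    have e1 : ‖(-(a * x)) ^ n‖ = ‖a ^ n * x ^ n‖ := by
      rw [neg_pow, hc.mul_pow]
      rcases neg_one_pow_eq_or A n with h | h <;> rw [h] <;> simp
    rw [e1]
    calc ‖a ^ n * x ^ n‖ ≤ ‖a ^ n‖ * ‖x ^ n‖ := norm_mul_le _ _
      _ ≤ (1 / (2 * (‖x‖ + 1))) ^ n * (‖x‖ + 1) ^ n := by
        gcongr
        exact (norm_pow_le' x hn0).trans (by gcongr; linarith)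
      _ = (1 / 2) ^ n := by
        rw [← mul_pow]; congr 1; field_simp
      _ < 1 := pow_lt_one₀ (by norm_num) (by norm_num) hn0.ne'
  have h2 := isUnit_one_sub_of_norm_lt_one h1
  rw [← mul_neg_geom_sum] at h2
  have h3 : Commute (1 - -(a * x)) (∑ i ∈ Finset.range n, (-(a * x)) ^ i) := by
    rw [Commute, SemiconjBy, mul_neg_geom_sum, geom_sum_mul_neg]
  have := (h3.isUnit_mul_iff.1 h2).1
  rwa [sub_neg_eq_add] at this

theorem qn_scalar {A : Type*} [NormedRing A] [NormedAlgebra ℂ A] {a : A}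
    (h : Quasinilpotent a) (z : ℂ) : IsUnit (1 + z • a) := by
  have := h (z • 1) (by simp)
  simpa using this

theorem qn_mul {A : Type*} [NormedRing A] [NormedAlgebra ℂ A] [CompleteSpace A] {a : A}
    (h : Quasinilpotent a) {x : A} (hx : x * a = a * x) : Quasinilpotent (a * x) := by
  apply qn_of_scalar
  intro z
  have := h (z • x) (by simp [hx])
  simpa using this

theorem qn_sub {A : Type*} [NormedRing A] [NormedAlgebra ℂ A] [CompleteSpace A] {a b : A}
    (ha : Quasinilpotent a) (hb : Quasinilpotent b) (hab : a * b = b * a) :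
    Quasinilpotent (a - b) := by
  apply qn_of_scalar
  intro z
  obtain ⟨u, hu⟩ := qn_scalar ha z
  have hc : Commute (u : A) b := by
    rw [hu]; exact (Commute.one_left _).add_left (Commute.smul_left hab z)
  have hc2 : Commute (↑u⁻¹ : A) b := hc.units_inv_left
  have h1 := hb ((-z) • (↑u⁻¹ : A)) (by simp [hc2.eq])
  have h2 := u.isUnit.mul h1
  convert h2 using 1
  rw [mul_add, mul_smul_comm, mul_smul_comm, ← hc2.eq, Units.mul_inv_cancel_left, hu]
  simp [smul_sub]
  abel

theorem qn_of_sq {A : Type*} [NormedRing A] [NormedAlgebra ℂ A] [CompleteSpace A] {a : A}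
    (h : Quasinilpotent (a * a)) : Quasinilpotent a := by
  apply qn_of_scalar
  intro z
  have h1 := qn_scalar h (- (z * z))
  have h2 : 1 + (-(z * z)) • (a * a) = (1 + z • a) * (1 - z • a) := by
    have : (z * z) • (a * a) = (z • a) * (z • a) := by rw [smul_mul_smul_comm]
    rw [neg_smul, this]; generalize z • a = t; noncomm_ring
  rw [h2] at h1
  have hc : Commute (1 + z • a) (1 - z • a) := by
    generalize z • a = t; rw [Commute, SemiconjBy]; noncomm_ring
  exact (hc.isUnit_mul_iff.1 h1).1

theorem catalan_le (n : ℕ) : catalan n ≤ 4 ^ n := by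
  rw [catalan_eq_centralBinom_div]
  exact (Nat.div_le_self _ _).trans (Nat.centralBinom_le_four_pow n)

open Filter Topology in
theorem exists_cat {A : Type*} [NormedRing A] [NormedAlgebra ℂ A] [CompleteSpace A] {x : A}
    (h : Quasinilpotent x) :
    ∃ c : A, c = 1 + x * (c * c) ∧ ∀ w, w * x = x * w → w * c = c * w := by
  let f : ℕ → A := fun n => catalan n • x ^ n
  have hs : Summable (fun n => ‖f n‖) := by
    refine Summable.of_norm_bounded_eventually_nat (g := fun n => (1 / 2 : ℝ) ^ n)
      (summable_geometric_of_lt_one (by norm_num) (by norm_num)) ?_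
    filter_upwards [qn_decay x (qn_scalar h) (1 / 8) (by norm_num)] with n hn
    rw [norm_norm]
    calc ‖f n‖ ≤ catalan n * ‖x ^ n‖ := norm_nsmul_le
      _ ≤ (4 : ℝ) ^ n * (1 / 8) ^ n := by
        gcongr
        exact_mod_cast catalan_le n
      _ = (1 / 2) ^ n := by rw [← mul_pow]; norm_num
  refine ⟨∑' n, f n, ?_, ?_⟩
  · have hcc := tsum_mul_tsum_eq_tsum_sum_antidiagonal_of_summable_norm hs hs
    have hsc := summable_norm_sum_mul_antidiagonal_of_summable_norm hs hs
    rw [hcc, ← hsc.of_norm.tsum_mul_left, hs.of_norm.tsum_eq_zero_add]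
    congr 1
    · simp [f]
    · congr 1
      ext n
      simp only [f]
      rw [catalan_succ', Finset.sum_smul, Finset.mul_sum]
      refine Finset.sum_congr rfl fun ij hij => ?_
      replace hij := Finset.HasAntidiagonal.mem_antidiagonal.1 hij
      rw [smul_mul_smul_comm, ← pow_add, hij, mul_smul_comm, ← pow_succ']
  · intro w hw
    exact Commute.tsum_right w fun n => (Commute.pow_right hw n).smul_right _

/-- Three pairwise commuting elements live in a commutative subring. -/
theorem comm3 {A : Type*} [Ring A] (a b c : A) (hab : a * b = b * a) (hac : a * c = c * a)
    (hbc : b * c = c * b) : ∃ S : Subring A, (∀ x y : S, x * y = y * x) ∧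
      a ∈ S ∧ b ∈ S ∧ c ∈ S := by
  have hs : ∀ x ∈ ({a, b, c} : Set A), ∀ y ∈ ({a, b, c} : Set A), x * y = y * x := by
    intro x hx y hy
    simp only [Set.mem_insert_iff, Set.mem_singleton_iff] at hx hy
    rcases hx with rfl | rfl | rfl <;> rcases hy with rfl | rfl | rfl <;> simp [*]
  refine ⟨Subring.closure {a, b, c}, ?_, ?_, ?_, ?_⟩
  · exact (Subring.isMulCommutative_closure hs).is_comm.comm
  all_goals exact Subring.subset_closure (by simp)

universe u in
/-- Transfer of a statement about three commuting elements to commutative rings. -/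
theorem transfer3 {A : Type u} [Ring A] {a b c : A} (hab : a * b = b * a) (hac : a * c = c * a)
    (hbc : b * c = c * b) : ∃ (R : Type u) (_ : CommRing R) (φ : R →+* A) (a' b' c' : R),
      Function.Injective φ ∧ a = φ a' ∧ b = φ b' ∧ c = φ c' := by
  obtain ⟨S, hS, ha, hb, hc⟩ := comm3 a b c hab hac hbc
  exact ⟨S, { (inferInstance : Ring S) with mul_comm := hS }, S.subtype, ⟨a, ha⟩, ⟨b, hb⟩, ⟨c, hc⟩,
    Subtype.val_injective, rfl, rfl, rfl⟩

theorem comm_unit_inv {A : Type*} [Ring A] {w : A} {u : Aˣ} (h : w * u = u * w) :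
    w * (↑u⁻¹ : A) = ↑u⁻¹ * w :=
  (Commute.units_inv_right (a := w) h).eq

/-- Lifting idempotents modulo quasinilpotents. -/
theorem exists_idem_qn {A : Type*} [NormedRing A] [NormedAlgebra ℂ A] [CompleteSpace A] {a : A}
    (h : Quasinilpotent (a - a * a)) :
    ∃ e : A, e * e = e ∧ Quasinilpotent (a - e) ∧ ∀ w, w * a = a * w → w * e = e * w := by
  obtain ⟨c, hc, hw⟩ := exists_cat h
  have hxa : ∀ w, w * a = a * w → w * (a - a * a) = (a - a * a) * w := fun w hwa =>
    (Commute.sub_right (a := w) hwa (Commute.mul_right hwa hwa)).eq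
  have hca : ∀ w, w * a = a * w → w * c = c * w := fun w hwa => hw w (hxa w hwa)
  have hac : a * c = c * a := hca a rfl
  have hq : Quasinilpotent ((a - a * a) * c) := qn_mul h (hxa c hac.symm)
  have hy : ∀ w, w * a = a * w → w * ((a - a * a) * c) = (a - a * a) * c * w := fun w hwa =>
    (Commute.mul_right (a := w) (hxa w hwa) (hca w hwa)).eq
  obtain ⟨u, hu⟩ := qn_scalar hq (-2)
  have hu2 : (u : A) = 1 - 2 * ((a - a * a) * c) := by
    rw [hu, neg_smul, ← sub_eq_add_neg, two_smul, two_mul]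
  have hv : (u : A) * ↑u⁻¹ = 1 := u.mul_inv
  have hva : ∀ w, w * a = a * w → w * (↑u⁻¹ : A) = ↑u⁻¹ * w := by
    intro w hwa
    apply comm_unit_inv
    rw [hu2]
    exact (Commute.sub_right (a := w) (Commute.one_right w)
      (Commute.mul_right (Nat.cast_commute 2 w).symm (hy w hwa))).eq
  generalize (↑u⁻¹ : A) = v at *
  rw [hu2] at hv
  clear hu hu2 u
  refine ⟨(a - (a - a * a) * c) * v, ?_, ?_, ?_⟩
  · obtain ⟨R, _, φ, a, c, v, hφ, rfl, rfl, rfl⟩ := transfer3 hac (hva a rfl) (hva c hac.symm)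
    have hone : φ 1 = 1 := map_one φ
    have htwo : φ 2 = 2 := map_ofNat φ 2
    replace hc : c = 1 + (a - a * a) * (c * c) := hφ (by simp only [map_mul, map_sub, map_add, map_one, map_ofNat]; exact hc)
    replace hv : (1 - 2 * ((a - a * a) * c)) * v = 1 := hφ (by simp only [map_mul, map_sub, map_add, map_one, map_ofNat]; exact hv)
    simp only [← map_mul, ← map_sub, ← map_add, ← hone, ← htwo, hφ.eq_iff]
    grind only
  · have e2 : a - (a - (a - a * a) * c) * v
        = ((a - a * a) * c) * (1 - 2 * ((a - (a - a * a) * c) * v)) := by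
      obtain ⟨R, _, φ, a, c, v, hφ, rfl, rfl, rfl⟩ := transfer3 hac (hva a rfl) (hva c hac.symm)
      have hone : φ 1 = 1 := map_one φ
      have htwo : φ 2 = 2 := map_ofNat φ 2
      replace hc : c = 1 + (a - a * a) * (c * c) := hφ (by simp only [map_mul, map_sub, map_add, map_one, map_ofNat]; exact hc)
      replace hv : (1 - 2 * ((a - a * a) * c)) * v = 1 := hφ (by simp only [map_mul, map_sub, map_add, map_one, map_ofNat]; exact hv)
      simp only [← map_mul, ← map_sub, ← map_add, ← hone, ← htwo, hφ.eq_iff]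
      grind only
    rw [e2]
    apply qn_mul hq
    obtain ⟨R, _, φ, a, c, v, hφ, rfl, rfl, rfl⟩ := transfer3 hac (hva a rfl) (hva c hac.symm)
    have hone : φ 1 = 1 := map_one φ
    have htwo : φ 2 = 2 := map_ofNat φ 2
    simp only [← map_mul, ← map_sub, ← map_add, ← hone, ← htwo, hφ.eq_iff]
    ring
  · intro w hwa
    exact (Commute.mul_right (a := w) (Commute.sub_right hwa (hy w hwa)) (hva w hwa)).eq

theorem gs_iff {A : Type*} [NormedRing A] [NormedAlgebra ℂ A] [CompleteSpace A] (a : A) :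
    (∃ b, IsGSDrazinInv a b) ↔ Quasinilpotent (a - a * a) := by
  constructor
  · rintro ⟨b, h1, h2, h3⟩
    have e1 : a - a * a = (a - a * b) * (1 - a - a * b) ∧
        (1 - a - a * b) * (a - a * b) = (a - a * b) * (1 - a - a * b) := by
      clear h3
      obtain ⟨R, _, φ, a, b, c, hφ, rfl, rfl, -⟩ := transfer3 h2 h2 rfl
      have hone : φ 1 = 1 := map_one φ
      have htwo : φ 2 = 2 := map_ofNat φ 2
      replace h1 : b = b * a * b := hφ (by simp only [map_mul, map_sub, map_add, map_one, map_ofNat]; exact h1)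
      simp only [← map_mul, ← map_sub, ← map_add, ← hone, ← htwo, hφ.eq_iff]
      constructor
      · linear_combination a * h1
      · ring
    rw [e1.1]
    exact qn_mul h3 e1.2
  · intro h
    obtain ⟨e, he, hq, hw⟩ := exists_idem_qn h
    have hae := hw a rfl
    obtain ⟨u, hu⟩ := qn_scalar hq 1
    rw [one_smul] at hu
    have hv : (u : A) * ↑u⁻¹ = 1 := u.mul_inv
    have hva : a * (↑u⁻¹ : A) = ↑u⁻¹ * a := by
      apply comm_unit_inv
      rw [hu, mul_add, add_mul, mul_sub, sub_mul, hae, mul_one, one_mul]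
    have hve : e * (↑u⁻¹ : A) = ↑u⁻¹ * e := by
      apply comm_unit_inv
      rw [hu, mul_add, add_mul, mul_sub, sub_mul, hae, mul_one, one_mul]
    generalize (↑u⁻¹ : A) = v at *
    rw [hu] at hv
    have key : a * (e * v) = e ∧ e * v = e * v * a * (e * v) ∧ a * (e * v) = e * v * a := by
      clear hq hw h hu u
      obtain ⟨R, _, φ, a, e, v, hφ, rfl, rfl, rfl⟩ := transfer3 hae hva hve
      have hone : φ 1 = 1 := map_one φ
      have htwo : φ 2 = 2 := map_ofNat φ 2
      replace he : e * e = e := hφ (by simp only [map_mul, map_sub, map_add, map_one, map_ofNat]; exact he)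
      replace hv : (1 + (a - e)) * v = 1 := hφ (by simp only [map_mul, map_sub, map_add, map_one, map_ofNat]; exact hv)
      simp only [← map_mul, ← map_sub, ← map_add, ← hone, ← htwo, hφ.eq_iff]
      refine ⟨?_, ?_, ?_⟩ <;> grind only
    refine ⟨e * v, key.2.1, key.2.2, ?_⟩
    rwa [key.1]

theorem hirano_iff {A : Type*} [NormedRing A] [NormedAlgebra ℂ A] [CompleteSpace A] (a : A) :
    (∃ b, IsGenHiranoInv a b) ↔ Quasinilpotent (a - a * a * a) := by
  constructor
  · rintro ⟨b, h1, h2, h3⟩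
    rw [pow_two] at h3
    apply qn_of_sq
    obtain ⟨r, hr, hr2⟩ : ∃ r, (a - a * a * a) * (a - a * a * a) = (a * a - a * b) * r ∧
        r * (a * a - a * b) = (a * a - a * b) * r := by
      refine ⟨a * b * (a * a - a * b) + (1 - a * a) * (1 - a * a), ?_⟩
      clear h3
      obtain ⟨R, _, φ, a, b, c, hφ, rfl, rfl, -⟩ := transfer3 h2 h2 rfl
      have hone : φ 1 = 1 := map_one φ
      have htwo : φ 2 = 2 := map_ofNat φ 2
      replace h1 : b = b * a * b := hφ (by simp only [map_mul, map_sub, map_add, map_one, map_ofNat]; exact h1)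
      simp only [← map_mul, ← map_sub, ← map_add, ← hone, ← htwo, hφ.eq_iff]
      constructor
      · grind
      · ring
    rw [hr]
    exact qn_mul h3 hr2
  · intro h
    have h' : Quasinilpotent (a * a - a * a * (a * a)) := by
      have := qn_mul (x := a) h (by noncomm_ring)
      convert this using 1
      noncomm_ring
    obtain ⟨e, he, hq, hw⟩ := exists_idem_qn h'
    have hae := hw a (by noncomm_ring)
    have haae := hw (a * a) rfl
    obtain ⟨u, hu⟩ := qn_scalar hq 1
    rw [one_smul] at hu
    have hv : (u : A) * ↑u⁻¹ = 1 := u.mul_inv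
    have hva : a * (↑u⁻¹ : A) = ↑u⁻¹ * a := by
      apply comm_unit_inv
      rw [hu, mul_add, add_mul, mul_sub, sub_mul, hae, mul_one, one_mul, mul_assoc]
    have hve : e * (↑u⁻¹ : A) = ↑u⁻¹ * e := by
      apply comm_unit_inv
      rw [hu, mul_add, add_mul, mul_sub, sub_mul, haae, mul_one, one_mul]
    generalize (↑u⁻¹ : A) = v at *
    rw [hu] at hv
    have key : a * (a * e * v) = e ∧ a * e * v = a * e * v * a * (a * e * v) ∧
        a * (a * e * v) = a * e * v * a := by
      clear hq hw h h' hu u haae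
      obtain ⟨R, _, φ, a, e, v, hφ, rfl, rfl, rfl⟩ := transfer3 hae hva hve
      have hone : φ 1 = 1 := map_one φ
      have htwo : φ 2 = 2 := map_ofNat φ 2
      replace he : e * e = e := hφ (by simp only [map_mul, map_sub, map_add, map_one, map_ofNat]; exact he)
      replace hv : (1 + (a * a - e)) * v = 1 := hφ (by simp only [map_mul, map_sub, map_add, map_one, map_ofNat]; exact hv)
      simp only [← map_mul, ← map_sub, ← map_add, ← hone, ← htwo, hφ.eq_iff]
      refine ⟨?_, ?_, ?_⟩ <;> grind only
    refine ⟨a * e * v, key.2.1, key.2.2, ?_⟩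
    rw [key.1, pow_two]; exact hq

theorem stmt4 {A : Type*} [NormedRing A] [NormedAlgebra ℂ A] [CompleteSpace A] (a : A) :
    (∃ b, IsGenHiranoInv a b) ↔
      ((∃ b, IsGSDrazinInv ((1 / 2 : ℂ) • (a ^ 2 + a)) b) ∧
        (∃ b, IsGSDrazinInv ((1 / 2 : ℂ) • (a ^ 2 - a)) b)) := by
  rw [hirano_iff, gs_iff, gs_iff]
  have two : ∀ w : A, w = (1 / 4 : ℂ) • (w + w + w + w) := by intro w; module
  have e1 : (1 / 2 : ℂ) • (a ^ 2 + a) - (1 / 2 : ℂ) • (a ^ 2 + a) * (1 / 2 : ℂ) • (a ^ 2 + a)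
      = (a - a * a * a) * ((1 / 4 : ℂ) • (a + 2)) := by
    rw [smul_mul_smul_comm, mul_smul_comm]
    have : (a - a * a * a) * (a + 2) = (a ^ 2 + a) + (a ^ 2 + a) - (a ^ 2 + a) * (a ^ 2 + a) := by
      noncomm_ring
    rw [this]; module
  have e2 : (1 / 2 : ℂ) • (a ^ 2 - a) - (1 / 2 : ℂ) • (a ^ 2 - a) * (1 / 2 : ℂ) • (a ^ 2 - a)
      = (a - a * a * a) * ((1 / 4 : ℂ) • (a - 2)) := by
    rw [smul_mul_smul_comm, mul_smul_comm]
    have : (a - a * a * a) * (a - 2) = (a ^ 2 - a) + (a ^ 2 - a) - (a ^ 2 - a) * (a ^ 2 - a) := by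
      noncomm_ring
    rw [this]; module
  rw [e1, e2]
  constructor
  · intro h
    refine ⟨qn_mul h ?_, qn_mul h ?_⟩
    · rw [smul_mul_assoc, mul_smul_comm]; congr 1; noncomm_ring
    · rw [smul_mul_assoc, mul_smul_comm]; congr 1; noncomm_ring
  · rintro ⟨h1, h2⟩
    have := qn_sub h1 h2 (by
      simp only [mul_smul_comm, smul_mul_assoc]; congr 2; noncomm_ring)
    convert this using 1
    rw [← mul_sub, ← smul_sub]
    have : (a + 2) - (a - 2) = (4 : ℂ) • (1 : A) := by
      rw [show (4 : ℂ) • (1 : A) = (2 : ℂ) • ((1 : A) + 1) by module, one_add_one_eq_two, two_smul]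
      abel
    rw [this, smul_smul]; norm_num
end

section
/- Let A be a complex Banach algebra with identity and let a, b, c ∈ A satisfy aba = aca. Then ac has a generalized Hirano inverse if and only if ba has a generalized Hirano inverse. -/
theorem isUnit_swap_aux {A : Type*} [Ring A] (x y : A) (h : IsUnit (1 + x * y)) :
    IsUnit (1 + y * x) := by
  obtain ⟨u, hu⟩ := h
  have h1 : (1 + x * y) * (↑u⁻¹ : A) = 1 := by rw [← hu]; simp
  have h2 : (↑u⁻¹ : A) * (1 + x * y) = 1 := by rw [← hu]; simp
  generalize (↑u⁻¹ : A) = v at h1 h2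
  refine ⟨⟨1 + y * x, 1 - y * v * x, ?_, ?_⟩, rfl⟩
  · have : (1 + y * x) * (1 - y * v * x) = 1 + y * x - y * ((1 + x * y) * v) * x := by noncomm_ring
    rw [this, h1]; noncomm_ring
  · have : (1 - y * v * x) * (1 + y * x) = 1 + y * x - y * (v * (1 + x * y)) * x := by noncomm_ring
    rw [this, h2]; noncomm_ring

theorem qnil_swap_aux {A : Type*} [Ring A] (x y : A) (h : Quasinilpotent (x * y)) :
    Quasinilpotent (y * x) := by
  intro z hz
  have hc : (x * (-(z * z)) * y) * (x * y) = (x * y) * (x * (-(z * z)) * y) := by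
    calc _ = -(x * (z * (z * (y * x))) * y) := by noncomm_ring
      _ = -(x * (z * (y * x * z)) * y) := by rw [hz]
      _ = -(x * ((z * (y * x)) * z) * y) := by noncomm_ring
      _ = _ := by rw [hz]; noncomm_ring
  have h1 := h _ hc
  have h2 : IsUnit (1 + y * (x * y * (x * (-(z * z))))) := by
    apply isUnit_swap_aux
    convert h1 using 1
    noncomm_ring
  have h3 : 1 + y * (x * y * (x * (-(z * z)))) = (1 + y * x * z) * (1 - y * x * z) := by
    have : (y * x * z) * (y * x * z) = y * x * (y * x) * (z * z) := by
      calc _ = y * x * (z * (y * x)) * z := by noncomm_ring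
        _ = _ := by rw [hz]; noncomm_ring
    calc _ = 1 - y * x * (y * x) * (z * z) := by noncomm_ring
      _ = _ := by rw [← this]; noncomm_ring
  rw [h3] at h2
  have hcm : Commute (1 + y * x * z) (1 - y * x * z) := by
    unfold Commute SemiconjBy; noncomm_ring
  exact (hcm.isUnit_mul_iff.mp h2).1

theorem stmt12 {A : Type*} [NormedRing A] [NormedAlgebra ℂ A] [CompleteSpace A] (a b c : A)
    (h : a * b * a = a * c * a) :
    (∃ x, IsGenHiranoInv (a * c) x) ↔ (∃ x, IsGenHiranoInv (b * a) x) := by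
  constructor
  · rintro ⟨g, h1, h2, h3⟩
    have e1 : a * c * (g * g) = g := by
      rw [← mul_assoc, h2]; exact h1.symm
    have e2 : a * b * g = a * c * g := by
      calc a * b * g = a * b * (a * c * (g * g)) := by rw [e1]
        _ = (a * b * a) * c * (g * g) := by noncomm_ring
        _ = a * c * (a * c * (g * g)) := by rw [h]; noncomm_ring
        _ = _ := by rw [e1]
    have f1 : b * a * (b * (g * g) * a) = b * g * a := by
      calc _ = b * ((a * b * g) * g) * a := by noncomm_ring
        _ = b * (a * c * (g * g)) * a := by rw [e2]; noncomm_ring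
        _ = _ := by rw [e1]
    have f2 : (b * (g * g) * a) * (b * a) = b * g * a := by
      calc _ = b * (g * g) * (a * b * a) := by noncomm_ring
        _ = b * (g * (g * (a * c))) * a := by rw [h]; noncomm_ring
        _ = b * (g * (a * c * g)) * a := by rw [← h2]
        _ = b * (g * (a * c) * g) * a := by noncomm_ring
        _ = _ := by rw [← h1]
    refine ⟨b * (g * g) * a, ?_, f1.trans f2.symm, ?_⟩
    · rw [f2]
      calc _ = b * ((g * (a * c) * g) * g) * a := by rw [← h1]
        _ = b * g * (a * c * g) * g * a := by noncomm_ring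
        _ = _ := by rw [← e2]; noncomm_ring
    · rw [f1]
      have : (b * a) ^ 2 - b * g * a = (b * (a * c - g)) * a := by
        calc _ = b * (a * b * a) - b * g * a := by noncomm_ring
          _ = _ := by rw [h]; noncomm_ring
      rw [this]
      apply qnil_swap_aux
      convert h3 using 1
      calc _ = (a * b * a) * c - a * b * g := by noncomm_ring
        _ = _ := by rw [h, e2]; noncomm_ring
  · rintro ⟨g, h1, h2, h3⟩
    have e1 : g * g * (b * a) = g := by
      rw [mul_assoc, ← h2, ← mul_assoc]; exact h1.symm
    have e1' : b * a * (g * g) = g := by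
      rw [← mul_assoc, h2]; exact h1.symm
    have e2 : g * (c * a) = g * (b * a) := by
      calc g * (c * a) = g * g * (b * a) * (c * a) := by rw [e1]
        _ = g * g * b * (a * c * a) := by noncomm_ring
        _ = (g * g * (b * a)) * (b * a) := by rw [← h]; noncomm_ring
        _ = _ := by rw [e1]
    have f1 : a * c * (a * (g * g) * c) = a * g * c := by
      calc _ = (a * c * a) * (g * g) * c := by noncomm_ring
        _ = a * (b * a * (g * g)) * c := by rw [← h]; noncomm_ring
        _ = _ := by rw [e1']
    have f2 : (a * (g * g) * c) * (a * c) = a * g * c := by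
      calc _ = a * g * (g * (c * a)) * c := by noncomm_ring
        _ = a * (g * g * (b * a)) * c := by rw [e2]; noncomm_ring
        _ = _ := by rw [e1]
    refine ⟨a * (g * g) * c, ?_, f1.trans f2.symm, ?_⟩
    · rw [f2]
      calc _ = a * ((g * (b * a) * g) * g) * c := by rw [← h1]
        _ = a * (g * (b * a)) * g * g * c := by noncomm_ring
        _ = _ := by rw [← e2]; noncomm_ring
    · rw [f1]
      have : (a * c) ^ 2 - a * g * c = a * ((b * a - g) * c) := by
        calc _ = (a * c * a) * c - a * g * c := by noncomm_ring
          _ = _ := by rw [← h]; noncomm_ring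
      rw [this]
      apply qnil_swap_aux
      convert h3 using 1
      calc _ = b * (a * c * a) - g * (c * a) := by noncomm_ring
        _ = _ := by rw [← h, e2, ← h2]; noncomm_ring
end
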